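/- Fix an integer d ≥ 1 and a real s > d. Let A ⊆ ℝ^d be compact with H_d(A) > 0, and for each N let ω_N ⊆ A be an N-point configuration such that E_s(ω_N)/N^{1+s/d} converges, as N → ∞, to the same (finite) limit as ℰ_s(A,N)/N^{1+s/d} (such configurations are called asymptotically s-energy minimizing). Then the normalized counting measures (1/N)∑_{x∈ω_N} δ_x converge weak-star to H_d restricted to A and normalized to a probability measure; equivalently, for every bounded continuous function f : ℝ^d → ℝ, (1/N)∑_{x∈ω_N} f(x) → (1/H_d(A)) ∫_A f dH_d as N → ∞. -/

import Mathlib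

open scoped ENNReal NNReal BigOperators Classical
open MeasureTheory Filter Metric Set Topology

/-- The Riesz `s`-energy of a finite configuration `ω`, valued in `[0,∞]`. -/
noncomputable def rieszEnergy {E : Type*} [PseudoEMetricSpace E] (s : ℝ) (ω : Finset E) : ℝ≥0∞ :=
  ∑ x ∈ ω, ∑ y ∈ ω, if x = y then 0 else edist x y ^ (-s)

/-- The `N`-point minimal Riesz `s`-energy over a set `A` (infimum over all `N`-point
subsets of `A`; `∞` if there is none). -/
noncomputable def minRieszEnergy {E : Type*} [PseudoEMetricSpace E] (s : ℝ) (A : Set E)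
    (N : ℕ) : ℝ≥0∞ :=
  ⨅ (ω : Finset E) (_ : ↑ω ⊆ A) (_ : ω.card = N), rieszEnergy s ω

/-- The Riesz kernel off the diagonal, extended by zero. -/
noncomputable def rieszKernel {E : Type*} [PseudoMetricSpace E] (s : ℝ) (x y : E) : ℝ :=
  if x = y then 0 else dist x y ^ (-s)

/-- The Riesz `s`-energy of a finite configuration in a metric space, as a real number. -/
noncomputable def realRieszEnergy {E : Type*} [PseudoMetricSpace E] (s : ℝ) (ω : Finset E) : ℝ :=
  ∑ x ∈ ω, ∑ y ∈ ω, rieszKernel s x y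

section RealRieszEnergy

variable {E F : Type*} [MetricSpace E] [MetricSpace F] {s : ℝ}

@[simp]
theorem rieszKernel_self (s : ℝ) (x : E) : rieszKernel s x x = 0 := if_pos rfl

theorem rieszKernel_of_ne (s : ℝ) {x y : E} (h : x ≠ y) : rieszKernel s x y = dist x y ^ (-s) :=
  if_neg h

theorem rieszKernel_nonneg (s : ℝ) (x y : E) : 0 ≤ rieszKernel s x y := by
  unfold rieszKernel
  split_ifs
  · exact le_rfl
  · positivity

theorem rieszKernel_of_dist_eq {φ : E → F} {r : ℝ} (hr : 0 < r)
    (hφ : ∀ x y, dist (φ x) (φ y) = r * dist x y) (x y : E) :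
    rieszKernel s (φ x) (φ y) = r ^ (-s) * rieszKernel s x y := by
  rcases eq_or_ne x y with rfl | h
  · simp
  have h' : φ x ≠ φ y := by
    rw [← dist_pos, hφ]
    exact mul_pos hr (dist_pos.2 h)
  rw [rieszKernel_of_ne s h, rieszKernel_of_ne s h', hφ, Real.mul_rpow hr.le dist_nonneg]

theorem realRieszEnergy_nonneg (s : ℝ) (ω : Finset E) : 0 ≤ realRieszEnergy s ω :=
  Finset.sum_nonneg fun _ _ ↦ Finset.sum_nonneg fun _ _ ↦ rieszKernel_nonneg s _ _

theorem rieszEnergy_eq_ofReal (s : ℝ) (ω : Finset E) :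
    rieszEnergy s ω = ENNReal.ofReal (realRieszEnergy s ω) := by
  unfold rieszEnergy realRieszEnergy
  rw [ENNReal.ofReal_sum_of_nonneg
    fun _ _ ↦ Finset.sum_nonneg fun _ _ ↦ rieszKernel_nonneg s _ _]
  refine Finset.sum_congr rfl fun x _ ↦ ?_
  rw [ENNReal.ofReal_sum_of_nonneg fun _ _ ↦ rieszKernel_nonneg s _ _]
  refine Finset.sum_congr rfl fun y _ ↦ ?_
  split_ifs with h
  · simp [h]
  · rw [rieszKernel_of_ne s h, edist_dist, ENNReal.ofReal_rpow_of_pos (dist_pos.2 h)]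

theorem realRieszEnergy_mono {ω ω' : Finset E} (h : ω ⊆ ω') :
    realRieszEnergy s ω ≤ realRieszEnergy s ω' := by
  unfold realRieszEnergy
  calc _ ≤ ∑ x ∈ ω, ∑ y ∈ ω', rieszKernel s x y :=
        Finset.sum_le_sum fun x _ ↦ Finset.sum_le_sum_of_subset_of_nonneg h
          fun _ _ _ ↦ rieszKernel_nonneg s _ _
    _ ≤ _ := Finset.sum_le_sum_of_subset_of_nonneg h
          fun _ _ _ ↦ Finset.sum_nonneg fun _ _ ↦ rieszKernel_nonneg s _ _

theorem realRieszEnergy_image [DecidableEq F] {φ : E → F} {r : ℝ} (hr : 0 < r)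
    (hφ : ∀ x y, dist (φ x) (φ y) = r * dist x y) (ω : Finset E) :
    realRieszEnergy s (ω.image φ) = r ^ (-s) * realRieszEnergy s ω := by
  have hinj : Function.Injective φ := fun x y hxy ↦ by
    have := hφ x y
    rw [hxy, dist_self, eq_comm, mul_eq_zero] at this
    exact dist_eq_zero.1 (this.resolve_left hr.ne')
  unfold realRieszEnergy
  rw [Finset.sum_image hinj.injOn, Finset.mul_sum]
  refine Finset.sum_congr rfl fun x _ ↦ ?_
  rw [Finset.sum_image hinj.injOn, Finset.mul_sum]
  exact Finset.sum_congr rfl fun y _ ↦ rieszKernel_of_dist_eq hr hφ x y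

theorem sum_realRieszEnergy_fiber_le {ι : Type*} [DecidableEq ι] (κ : E → ι) (ω : Finset E) :
    ∑ k ∈ ω.image κ, realRieszEnergy s (ω.filter (κ · = k)) ≤ realRieszEnergy s ω := by
  unfold realRieszEnergy
  rw [← Finset.sum_fiberwise_of_maps_to (s := ω) (g := κ) (t := ω.image κ)
    (fun x hx ↦ Finset.mem_image_of_mem κ hx)]
  refine Finset.sum_le_sum fun k _ ↦ Finset.sum_le_sum fun x _ ↦ ?_
  exact Finset.sum_le_sum_of_subset_of_nonneg (Finset.filter_subset _ _)
    fun _ _ _ ↦ rieszKernel_nonneg s _ _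

theorem sub_one_mul_le_realRieszEnergy (hs : 0 ≤ s) {r : ℝ} (hr : 0 ≤ r) {ω : Finset E}
    (hω : ∀ x ∈ ω, ∀ y ∈ ω, dist x y ≤ r) :
    r ^ (-s) * ((ω.card : ℝ) - 1) ≤ realRieszEnergy s ω := by
  have hrs := Real.rpow_nonneg hr (-s)
  by_cases hcard : ω.card ≤ 1
  · have : (ω.card : ℝ) ≤ 1 := mod_cast hcard
    nlinarith [realRieszEnergy_nonneg s ω]
  · have h1 : ∀ x ∈ ω, r ^ (-s) ≤ ∑ y ∈ ω, rieszKernel s x y := by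
      intro x hx
      obtain ⟨y, hy, hyx⟩ := Finset.exists_mem_ne (not_le.1 hcard) x
      refine le_trans ?_ (Finset.single_le_sum (fun y _ ↦ rieszKernel_nonneg s x y) hy)
      rw [rieszKernel_of_ne s hyx.symm]
      exact Real.rpow_le_rpow_of_nonpos (dist_pos.2 hyx.symm) (hω x hx y hy) (neg_nonpos.2 hs)
    have h2 := Finset.sum_le_sum h1
    rw [Finset.sum_const, nsmul_eq_mul] at h2
    have h3 : (ω.card : ℝ) * r ^ (-s) ≤ realRieszEnergy s ω := h2
    nlinarith

end RealRieszEnergy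

section Grid

variable {d : ℕ}

/-- The index of the cell containing `x` in the cubic grid of mesh `h` with origin `t`. -/
noncomputable def gridIndex (h : ℝ) (t x : EuclideanSpace ℝ (Fin d)) : Fin d → ℤ :=
  fun i ↦ ⌊(x i - t i) / h⌋

/-- The half-open unit cube. -/
def unitBox (d : ℕ) : Set (EuclideanSpace ℝ (Fin d)) := {x | ∀ i, x i ∈ Ico (0 : ℝ) 1}

theorem dist_le_sqrt_mul {x y : EuclideanSpace ℝ (Fin d)} {r : ℝ} (hr : 0 ≤ r)
    (h : ∀ i, |x i - y i| ≤ r) : dist x y ≤ √d * r := by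
  rw [EuclideanSpace.dist_eq, ← Real.sqrt_sq hr, ← Real.sqrt_mul (Nat.cast_nonneg d)]
  refine Real.sqrt_le_sqrt ?_
  calc _ ≤ ∑ i : Fin d, r ^ 2 := Finset.sum_le_sum fun i _ ↦ by
        rw [Real.dist_eq]
        exact pow_le_pow_left₀ (abs_nonneg _) (h i) 2
    _ = _ := by simp

theorem abs_sub_le_dist (x y : EuclideanSpace ℝ (Fin d)) (i : Fin d) : |x i - y i| ≤ dist x y := by
  rw [dist_eq_norm]
  simpa using PiLp.norm_apply_le (x - y) i

theorem gridIndex_eq_iff {h : ℝ} (hh : 0 < h) {t x : EuclideanSpace ℝ (Fin d)} {k : Fin d → ℤ} :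
    gridIndex h t x = k ↔ ∀ i, x i ∈ Ico (t i + h * k i) (t i + h * (k i + 1)) := by
  simp only [gridIndex, funext_iff, Int.floor_eq_iff, mem_Ico, le_div_iff₀ hh, div_lt_iff₀ hh]
  refine forall_congr' fun i ↦ and_congr ?_ ?_ <;> constructor <;> intro h <;> linarith

theorem dist_le_of_gridIndex_eq {h : ℝ} (hh : 0 < h) {t x y : EuclideanSpace ℝ (Fin d)}
    (hxy : gridIndex h t x = gridIndex h t y) : dist x y ≤ √d * h := by
  refine dist_le_sqrt_mul hh.le fun i ↦ ?_
  have h1 := (gridIndex_eq_iff hh).1 hxy i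
  have h2 := (gridIndex_eq_iff hh (t := t) (x := y)).1 rfl i
  rw [abs_le]
  constructor <;> linarith [h1.1, h1.2, h2.1, h2.2]

theorem gridCell_eq {h : ℝ} (hh : 0 < h) (t : EuclideanSpace ℝ (Fin d)) (k : Fin d → ℤ) :
    {x | gridIndex h t x = k} = (WithLp.ofLp : EuclideanSpace ℝ (Fin d) → Fin d → ℝ) ⁻¹'
      Set.univ.pi fun i ↦ Ico (t i + h * k i) (t i + h * (k i + 1)) := by
  ext x
  simp [gridIndex_eq_iff hh, Set.mem_pi]

theorem measurableSet_gridCell {h : ℝ} (hh : 0 < h) (t : EuclideanSpace ℝ (Fin d))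
    (k : Fin d → ℤ) : MeasurableSet {x | gridIndex h t x = k} := by
  rw [gridCell_eq hh]
  exact (PiLp.volume_preserving_ofLp (Fin d)).measurable
    (MeasurableSet.univ_pi fun i ↦ measurableSet_Ico)

theorem volume_gridCell {h : ℝ} (hh : 0 < h) (t : EuclideanSpace ℝ (Fin d)) (k : Fin d → ℤ) :
    volume {x | gridIndex h t x = k} = ENNReal.ofReal (h ^ d) := by
  rw [gridCell_eq hh, (PiLp.volume_preserving_ofLp (Fin d)).measure_preimage
    (MeasurableSet.univ_pi fun i ↦ measurableSet_Ico).nullMeasurableSet, Real.volume_pi_Ico,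
    ENNReal.ofReal_pow hh.le]
  simp [mul_add]

theorem exists_card_gridIndex_mul_le {B : Set (EuclideanSpace ℝ (Fin d))} (hB : IsCompact B)
    {v : ℝ} (hv : (volume B).toReal < v) :
    ∃ h₀ > 0, ∀ h, 0 < h → h < h₀ → ∀ t, ∀ S : Finset (Fin d → ℤ),
      (∀ k ∈ S, ∃ x ∈ B, gridIndex h t x = k) → S.card * h ^ d ≤ v := by
  have hv0 : 0 < v := ENNReal.toReal_nonneg.trans_lt hv
  have hlt : volume B < ENNReal.ofReal v :=
    (ENNReal.lt_ofReal_iff_toReal_lt hB.measure_lt_top.ne).2 hv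
  have h1 : ∀ᶠ δ in 𝓝[>] (0 : ℝ), volume (cthickening δ B) < ENNReal.ofReal v :=
    ((tendsto_measure_cthickening_of_isCompact hB).eventually_lt_const hlt).filter_mono
      nhdsWithin_le_nhds
  obtain ⟨δ, hδ, hδ0⟩ := (h1.and self_mem_nhdsWithin).exists
  have hδ0 : 0 < δ := hδ0
  have hd1 : 0 < √(d : ℝ) + 1 := by positivity
  refine ⟨δ / (√d + 1), by positivity, fun h hh hlt t S hS ↦ ?_⟩
  rw [lt_div_iff₀ hd1] at hlt
  have hsub : (⋃ k ∈ S, {x | gridIndex h t x = k}) ⊆ cthickening δ B := by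
    intro y hy
    simp only [mem_iUnion, mem_ofPred_eq, exists_prop] at hy
    obtain ⟨k, hk, hyk⟩ := hy
    obtain ⟨x, hxB, hx⟩ := hS k hk
    refine mem_cthickening_of_dist_le y x δ B hxB ?_
    have := dist_le_of_gridIndex_eq hh (hyk.trans hx.symm)
    nlinarith
  have h2 := (measure_mono hsub).trans_lt hδ
  rw [measure_biUnion_finset (fun k _ l _ hkl ↦ Set.disjoint_left.2 fun x hx hy ↦
    hkl (hx.symm.trans hy)) (fun k _ ↦ measurableSet_gridCell hh t k)] at h2
  simp only [volume_gridCell hh, Finset.sum_const, nsmul_eq_mul] at h2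
  rw [← ENNReal.ofReal_natCast, ← ENNReal.ofReal_mul (Nat.cast_nonneg _)] at h2
  exact ((ENNReal.ofReal_lt_ofReal_iff hv0).1 h2).le

theorem sum_fiber_le_realRieszEnergy {s h : ℝ} (hh : 0 < h) (t : EuclideanSpace ℝ (Fin d))
    {g : ℕ → ℝ} (hg : ∀ ω : Finset (EuclideanSpace ℝ (Fin d)), ↑ω ⊆ unitBox d → ω.Nonempty →
      g ω.card ≤ realRieszEnergy s ω) (ω : Finset (EuclideanSpace ℝ (Fin d))) :
    h ^ (-s) * ∑ k ∈ ω.image (gridIndex h t), g (ω.filter (gridIndex h t · = k)).card ≤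
      realRieszEnergy s ω := by
  refine le_trans ?_ (sum_realRieszEnergy_fiber_le (gridIndex h t) ω)
  rw [Finset.mul_sum]
  refine Finset.sum_le_sum fun k hk ↦ ?_
  set ω' := ω.filter (gridIndex h t · = k)
  let φ : EuclideanSpace ℝ (Fin d) → EuclideanSpace ℝ (Fin d) := fun x ↦
    h⁻¹ • (x - t) - WithLp.toLp 2 (fun i ↦ (k i : ℝ))
  have hφ : ∀ x y, dist (φ x) (φ y) = h⁻¹ * dist x y := fun x y ↦ by
    simp [φ, dist_smul₀, abs_of_pos hh]
  have hinv : 0 < h⁻¹ := inv_pos.2 hh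
  have hinj : Function.Injective φ := fun x y hxy ↦ by
    have := hφ x y
    rw [hxy, dist_self, eq_comm, mul_eq_zero] at this
    exact dist_eq_zero.1 (this.resolve_left hinv.ne')
  have hne : ω'.Nonempty := by
    obtain ⟨x, hx, hxk⟩ := Finset.mem_image.1 hk
    exact ⟨x, Finset.mem_filter.2 ⟨hx, hxk⟩⟩
  have h1 := hg (ω'.image φ) (by
    intro y hy
    obtain ⟨x, hx, rfl⟩ := Finset.mem_image.1 (Finset.mem_coe.1 hy)
    intro i
    have := congrFun (Finset.mem_filter.1 hx).2 i
    rw [gridIndex, Int.floor_eq_iff] at this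
    have e : φ x i = (x i - t i) / h - k i := by simp [φ, div_eq_inv_mul]
    rw [e]
    constructor <;> linarith [this.1, this.2]) (hne.image _)
  rw [Finset.card_image_of_injective _ hinj, realRieszEnergy_image hinv hφ] at h1
  rw [Real.inv_rpow hh.le] at h1
  have hp : 0 < h ^ (-s) := Real.rpow_pos_of_pos hh _
  calc _ ≤ h ^ (-s) * ((h ^ (-s))⁻¹ * realRieszEnergy s ω') := by gcongr
    _ = _ := by field_simp

end Grid

section LowerBound

variable {d : ℕ} {s : ℝ}

theorem rpow_neg_eq_pow_rpow (hd : 1 ≤ d) {h : ℝ} (hh : 0 < h) :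
    h ^ (-s) = (h ^ d) ^ (-(s / d)) := by
  have : (d : ℝ) ≠ 0 := by positivity
  rw [← Real.rpow_natCast, ← Real.rpow_mul hh.le]
  congr 1
  field_simp

/-- The energy of an `n`-point configuration in the unit cube is at least `c * n ^ (1 + s / d)`,
up to an additive constant. -/
def HasEnergyLowerBound (d : ℕ) (s c : ℝ) : Prop :=
  ∃ K : ℝ, 0 ≤ K ∧ ∀ ω : Finset (EuclideanSpace ℝ (Fin d)), ↑ω ⊆ unitBox d →
    c * (ω.card : ℝ) ^ (1 + s / d) - K ≤ realRieszEnergy s ω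

theorem HasEnergyLowerBound.mono {c c' : ℝ} (h : HasEnergyLowerBound d s c) (hc : c' ≤ c) :
    HasEnergyLowerBound d s c' := by
  obtain ⟨K, hK, H⟩ := h
  refine ⟨K, hK, fun ω hω ↦ le_trans ?_ (H ω hω)⟩
  gcongr

theorem sum_card_fiber_eq {ι α : Type*} [DecidableEq ι] (κ : α → ι) (ω : Finset α) :
    ∑ k ∈ ω.image κ, ((ω.filter (κ · = k)).card : ℝ) = ω.card := by
  rw [Finset.card_eq_sum_card_image κ ω, Nat.cast_sum]

theorem exists_hasEnergyLowerBound (hd : 1 ≤ d) (hs : 0 < s) :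
    ∃ c > 0, HasEnergyLowerBound d s c := by
  have hd0 : (0 : ℝ) < d := by positivity
  set a : ℝ := √d ^ (-s)
  have ha : 0 < a := by positivity
  let B : Set (EuclideanSpace ℝ (Fin d)) := closedBall 0 (√d)
  set v : ℝ := (volume B).toReal + 1
  have hv : 0 < v := by positivity
  obtain ⟨h₀, hh₀, H⟩ := exists_card_gridIndex_mul_le (B := B) (isCompact_closedBall _ _)
    (v := v) (lt_add_one _)
  set c : ℝ := a / 2 * (2 * v) ^ (-(s / d))
  have hc : 0 < c := by positivity
  refine ⟨c, hc, c * (2 * v / h₀ ^ d) ^ (1 + s / d), by positivity, fun ω hω ↦ ?_⟩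
  have hE := realRieszEnergy_nonneg s ω
  rcases ω.eq_empty_or_nonempty with rfl | hne
  · simp only [Finset.card_empty, Nat.cast_zero]
    rw [Real.zero_rpow (by positivity)]
    have : 0 ≤ c * (2 * v / h₀ ^ d) ^ (1 + s / d) := by positivity
    linarith
  have hn : (0 : ℝ) < ω.card := mod_cast hne.card_pos
  by_cases hsmall : (ω.card : ℝ) ≤ 2 * v / h₀ ^ d
  · have : c * (ω.card : ℝ) ^ (1 + s / d) ≤ c * (2 * v / h₀ ^ d) ^ (1 + s / d) := by gcongr
    linarith
  set h : ℝ := (2 * v / ω.card) ^ ((d : ℝ)⁻¹)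
  have hh : 0 < h := by positivity
  have hhd : h ^ d = 2 * v / ω.card := Real.rpow_inv_natCast_pow (by positivity) (by lia)
  have hlt : h < h₀ := by
    refine lt_of_pow_lt_pow_left₀ d hh₀.le ?_
    rw [hhd, div_lt_iff₀ hn]
    rw [not_le, div_lt_iff₀ (by positivity)] at hsmall
    linarith
  have h1 := sum_fiber_le_realRieszEnergy (s := s) hh 0 (g := fun n ↦ a * ((n : ℝ) - 1))
    (fun ω hω _ ↦ sub_one_mul_le_realRieszEnergy hs.le (Real.sqrt_nonneg _) fun x hx y hy ↦ by
      have := dist_le_sqrt_mul (x := x) (y := y) zero_le_one fun i ↦ by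
        have h1 := hω hx i
        have h2 := hω hy i
        rw [abs_le]
        constructor <;> linarith [h1.1, h1.2, h2.1, h2.2]
      rwa [mul_one] at this) ω
  simp only [← Finset.mul_sum, Finset.sum_sub_distrib, sum_card_fiber_eq] at h1
  have h2 := H h hh hlt 0 (ω.image (gridIndex h 0)) (by
    intro k hk
    obtain ⟨x, hx, rfl⟩ := Finset.mem_image.1 hk
    refine ⟨x, ?_, rfl⟩
    rw [mem_closedBall]
    have := dist_le_sqrt_mul (x := x) (y := 0) zero_le_one fun i ↦ by
      have h1 := hω hx i
      rw [abs_le]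
      constructor <;> simp <;> linarith [h1.1, h1.2]
    rwa [mul_one] at this)
  rw [hhd, mul_div_assoc', div_le_iff₀ hn] at h2
  simp only [Finset.sum_const, nsmul_eq_mul, mul_one] at h1
  have h3 : ((ω.image (gridIndex h 0)).card : ℝ) ≤ ω.card / 2 := by nlinarith
  have h4 : h ^ (-s) = (2 * v) ^ (-(s / d)) * (ω.card : ℝ) ^ (s / d) := by
    rw [rpow_neg_eq_pow_rpow hd hh, hhd, Real.div_rpow (by positivity) hn.le,
      Real.rpow_neg hn.le, div_inv_eq_mul]
  have h5 : c * (ω.card : ℝ) ^ (1 + s / d) ≤ realRieszEnergy s ω := by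
    refine le_trans ?_ h1
    rw [h4, Real.rpow_add hn, Real.rpow_one]
    calc _ = (2 * v) ^ (-(s / d)) * (ω.card : ℝ) ^ (s / d) * (a * (ω.card / 2)) := by
          simp only [c]; ring
      _ ≤ _ := by gcongr; linarith
  have : 0 ≤ c * (2 * v / h₀ ^ d) ^ (1 + s / d) := by positivity
  linarith

theorem tangent_le_rpow {τ x y : ℝ} (hτ : 0 < τ) (hx : 0 ≤ x) (hy : 0 ≤ y) :
    (1 + τ) * y ^ τ * x - τ * y ^ (1 + τ) ≤ x ^ (1 + τ) := by
  have hpq : (1 + τ).HolderConjugate ((1 + τ) / τ) := by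
    rw [Real.holderConjugate_iff]
    refine ⟨by linarith, ?_⟩
    field_simp
  have h := Real.young_inequality_of_nonneg hx (Real.rpow_nonneg hy τ) hpq
  rw [← Real.rpow_mul hy, mul_div_cancel₀ _ hτ.ne'] at h
  have h1 : 0 < 1 + τ := by linarith
  have e : x ^ (1 + τ) / (1 + τ) + y ^ (1 + τ) / ((1 + τ) / τ) =
      (x ^ (1 + τ) + τ * y ^ (1 + τ)) / (1 + τ) := by
    field_simp
  rw [e, le_div_iff₀ h1] at h
  linarith

theorem HasEnergyLowerBound.exists_le_of_isCompact (hd : 1 ≤ d) (hs : 0 < s) {c : ℝ} (hc0 : 0 ≤ c)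
    (hc : HasEnergyLowerBound d s c) {B : Set (EuclideanSpace ℝ (Fin d))} (hB : IsCompact B)
    {v : ℝ} (hv : (volume B).toReal < v) :
    ∃ K : ℝ, ∀ ω : Finset (EuclideanSpace ℝ (Fin d)), ↑ω ⊆ B → ∀ M : ℝ, 0 ≤ M →
      c * ((1 + s / d) * M ^ (s / d) * ω.card - s / d * M ^ (1 + s / d) * v) - K ≤
        realRieszEnergy s ω := by
  obtain ⟨h₀, hh₀, H⟩ := exists_card_gridIndex_mul_le hB hv
  obtain ⟨K, hK, hlow⟩ := hc
  set h := h₀ / 2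
  have hh : 0 < h := by positivity
  have hτ : 0 < s / d := by positivity
  have hhd : 0 < h ^ d := by positivity
  refine ⟨h ^ (-s) * (v / h ^ d * K), fun ω hω M hM ↦ ?_⟩
  have h2 := H h hh (half_lt_self hh₀) 0 (ω.image (gridIndex h 0)) (by
    intro k hk
    obtain ⟨x, hx, rfl⟩ := Finset.mem_image.1 hk
    exact ⟨x, hω hx, rfl⟩)
  rw [← le_div_iff₀ hhd] at h2
  set y := M * h ^ d
  have hy : 0 ≤ y := by positivity
  have h1 := sum_fiber_le_realRieszEnergy (s := s) hh 0
    (g := fun n ↦ c * (1 + s / d) * y ^ (s / d) * n - (c * (s / d * y ^ (1 + s / d)) + K))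
    (fun ω hω _ ↦ by
      refine le_trans ?_ (hlow ω hω)
      have := mul_le_mul_of_nonneg_left
        (tangent_le_rpow hτ (Nat.cast_nonneg (α := ℝ) ω.card) hy) hc0
      linarith) ω
  refine le_trans ?_ h1
  rw [Finset.sum_sub_distrib, ← Finset.mul_sum, sum_card_fiber_eq, Finset.sum_const, nsmul_eq_mul]
  have h3 : ((ω.image (gridIndex h 0)).card : ℝ) * (c * (s / d * y ^ (1 + s / d)) + K) ≤
      v / h ^ d * (c * (s / d * y ^ (1 + s / d)) + K) := by gcongr
  have hp : 0 < h ^ (-s) := Real.rpow_pos_of_pos hh _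
  refine le_trans (le_of_eq ?_) (mul_le_mul_of_nonneg_left (sub_le_sub_left h3 _) hp.le)
  have e1 : h ^ (-s) * y ^ (s / d) = M ^ (s / d) := by
    rw [rpow_neg_eq_pow_rpow hd hh, Real.mul_rpow hM hhd.le, mul_left_comm, ← Real.rpow_add hhd]
    simp
  have e2 : h ^ (-s) * (y ^ (1 + s / d) / h ^ d) = M ^ (1 + s / d) := by
    rw [Real.mul_rpow hM hhd.le, rpow_neg_eq_pow_rpow hd hh, mul_div_assoc, mul_left_comm,
      Real.rpow_add hhd, Real.rpow_one, mul_div_cancel_left₀ _ hhd.ne', ← Real.rpow_add hhd]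
    simp
  rw [← e1, ← e2]
  ring

end LowerBound

section UpperBound

variable {d : ℕ} {s : ℝ}

theorem summable_norm_rpow_neg_fin (hs : (d : ℝ) < s) :
    Summable fun m : Fin d → ℤ ↦ ‖m‖ ^ (-s) := by
  let b := Pi.basisFun ℝ (Fin d)
  let L := Submodule.span ℤ (Set.range b)
  let e : (Fin d → ℤ) → L := fun m ↦ ⟨fun i ↦ (m i : ℝ), by
    rw [b.mem_span_iff_repr_mem ℤ]
    intro i
    exact ⟨m i, by simp [b]⟩⟩
  have he : Function.Injective e := fun m m' h ↦ by
    ext i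
    have h1 : ((m i : ℤ) : ℝ) = m' i := congrFun (congrArg Subtype.val h) i
    exact_mod_cast h1
  have hr : -s < -(Module.finrank ℤ L : ℝ) := by
    rw [ZLattice.rank ℝ L]
    simpa using hs
  refine ((ZLattice.summable_norm_rpow L (-s) hr).comp_injective he).congr fun m ↦ ?_
  have : ‖e m‖ = ‖m‖ := by
    change ‖(fun i ↦ (m i : ℝ))‖ = ‖m‖
    simp only [Pi.norm_def]
    rfl
  simp only [Function.comp_apply, this]

/-- The point of the `k`-th cell of the grid of mesh `h` with origin `t` obtained by shrinking the
unit cube by the factor `1 - γ`, scaling it to the cell and taking the image of `y`. -/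
noncomputable def gridPoint (h γ : ℝ) (t : EuclideanSpace ℝ (Fin d)) (k : Fin d → ℤ)
    (y : EuclideanSpace ℝ (Fin d)) : EuclideanSpace ℝ (Fin d) :=
  t + h • (WithLp.toLp 2 (fun i ↦ (k i : ℝ)) + (1 - γ) • y)

theorem gridPoint_apply (h γ : ℝ) (t : EuclideanSpace ℝ (Fin d)) (k : Fin d → ℤ)
    (y : EuclideanSpace ℝ (Fin d)) (i : Fin d) :
    gridPoint h γ t k y i = t i + h * (k i + (1 - γ) * y i) := by
  simp [gridPoint, mul_add]

theorem gridIndex_gridPoint {h γ : ℝ} (hh : 0 < h) (hγ0 : 0 < γ) (hγ1 : γ < 1)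
    (t : EuclideanSpace ℝ (Fin d)) (k : Fin d → ℤ) {y : EuclideanSpace ℝ (Fin d)}
    (hy : y ∈ unitBox d) : gridIndex h t (gridPoint h γ t k y) = k := by
  rw [gridIndex_eq_iff hh]
  intro i
  rw [gridPoint_apply]
  have h0 : 0 ≤ (1 - γ) * y i := mul_nonneg (by linarith) (hy i).1
  have h1 : (1 - γ) * y i < 1 := by nlinarith [(hy i).1, (hy i).2]
  constructor
  · gcongr
    linarith
  · gcongr

theorem mul_norm_sub_le_dist_gridPoint {h γ : ℝ} (hh : 0 < h) (hγ0 : 0 < γ) (hγ1 : γ < 1)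
    (t : EuclideanSpace ℝ (Fin d)) (k l : Fin d → ℤ) {y z : EuclideanSpace ℝ (Fin d)}
    (hy : y ∈ unitBox d) (hz : z ∈ unitBox d) :
    γ * h * ‖k - l‖ ≤ dist (gridPoint h γ t k y) (gridPoint h γ t l z) := by
  rw [← le_div_iff₀' (by positivity), pi_norm_le_iff_of_nonneg (by positivity)]
  intro i
  rw [le_div_iff₀' (by positivity)]
  refine le_trans ?_ (abs_sub_le_dist _ _ i)
  rw [gridPoint_apply, gridPoint_apply, Pi.sub_apply, Int.norm_eq_abs]
  have e : t i + h * (k i + (1 - γ) * y i) - (t i + h * (l i + (1 - γ) * z i)) =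
      h * (((k i - l i : ℤ) : ℝ) + (1 - γ) * (y i - z i)) := by push_cast; ring
  rw [e, abs_mul, abs_of_pos hh, mul_comm γ, mul_assoc]
  gcongr
  generalize hm : k i - l i = m
  have hyz : |y i - z i| ≤ 1 := by
    rw [abs_le]
    constructor <;> linarith [(hy i).1, (hy i).2, (hz i).1, (hz i).2]
  rcases eq_or_ne m 0 with rfl | hm0
  · simp only [Int.cast_zero, abs_zero, mul_zero]
    positivity
  have hm1 : (1 : ℝ) ≤ |(m : ℝ)| := by exact_mod_cast Int.one_le_abs hm0
  have h1 : |(m : ℝ)| ≤ |m + (1 - γ) * (y i - z i)| + |(1 - γ) * (y i - z i)| := by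
    have := abs_sub (m + (1 - γ) * (y i - z i)) ((1 - γ) * (y i - z i))
    rwa [add_sub_cancel_right] at this
  have h2 : |(1 - γ) * (y i - z i)| ≤ 1 - γ := by
    rw [abs_mul, abs_of_pos (by linarith)]
    nlinarith
  nlinarith

theorem dist_gridPoint_same {h γ : ℝ} (hh : 0 < h) (hγ1 : γ < 1)
    (t : EuclideanSpace ℝ (Fin d)) (k : Fin d → ℤ) (y z : EuclideanSpace ℝ (Fin d)) :
    dist (gridPoint h γ t k y) (gridPoint h γ t k z) = (1 - γ) * h * dist y z := by
  simp only [gridPoint, dist_add_left, dist_smul₀, Real.norm_eq_abs, abs_of_pos hh,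
    abs_of_pos (sub_pos.2 hγ1)]
  ring

theorem gridPoint_injOn {h γ : ℝ} (hh : 0 < h) (hγ0 : 0 < γ) (hγ1 : γ < 1)
    (t : EuclideanSpace ℝ (Fin d)) :
    Set.InjOn (fun p : (Fin d → ℤ) × EuclideanSpace ℝ (Fin d) ↦ gridPoint h γ t p.1 p.2)
      {p | p.2 ∈ unitBox d} := by
  rintro ⟨k, y⟩ hy ⟨l, z⟩ hz hyz
  have hkl : k = l := by
    rw [← gridIndex_gridPoint hh hγ0 hγ1 t k hy, ← gridIndex_gridPoint hh hγ0 hγ1 t l hz]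
    exact congrArg _ hyz
  subst hkl
  have h1 := dist_gridPoint_same hh hγ1 t k y z
  have h2 : gridPoint h γ t k y = gridPoint h γ t k z := hyz
  rw [h2, dist_self, eq_comm, mul_eq_zero] at h1
  have : (1 - γ) * h ≠ 0 := (mul_pos (by linarith) hh).ne'
  rw [dist_eq_zero.1 (h1.resolve_left this)]

theorem realRieszEnergy_image_gridPoint_le (hs : (d : ℝ) < s) {h γ : ℝ} (hh : 0 < h)
    (hγ0 : 0 < γ) (hγ1 : γ < 1) (t : EuclideanSpace ℝ (Fin d))
    {ω₀ : Finset (EuclideanSpace ℝ (Fin d))} (hω₀ : ↑ω₀ ⊆ unitBox d) (S : Finset (Fin d → ℤ)) :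
    realRieszEnergy s ((S ×ˢ ω₀).image fun p ↦ gridPoint h γ t p.1 p.2) ≤
      S.card * (((1 - γ) * h) ^ (-s) * realRieszEnergy s ω₀ +
        (ω₀.card : ℝ) ^ 2 * ((γ * h) ^ (-s) * ∑' m : Fin d → ℤ, ‖m‖ ^ (-s))) := by
  have hs0 : 0 < s := (Nat.cast_nonneg d).trans_lt hs
  have hinj : Set.InjOn
      (fun p : (Fin d → ℤ) × EuclideanSpace ℝ (Fin d) ↦ gridPoint h γ t p.1 p.2)
      ↑(S ×ˢ ω₀) :=
    (gridPoint_injOn hh hγ0 hγ1 t).mono fun p hp ↦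
      hω₀ (Finset.mem_product.1 (Finset.mem_coe.1 hp)).2
  have hterm : ∀ k ∈ S, ∀ y ∈ ω₀, ∀ l ∈ S, ∀ z ∈ ω₀,
      rieszKernel s (gridPoint h γ t k y) (gridPoint h γ t l z) ≤
      (if k = l then ((1 - γ) * h) ^ (-s) * rieszKernel s y z else 0) +
        (γ * h) ^ (-s) * ‖k - l‖ ^ (-s) := by
    intro k _ y hy l _ z hz
    have hnn : 0 ≤ (γ * h) ^ (-s) * ‖k - l‖ ^ (-s) := by positivity
    by_cases hkl : k = l
    · subst hkl
      refine le_trans (le_of_eq ?_) (le_add_of_nonneg_right hnn)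
      rw [if_pos rfl]
      exact rieszKernel_of_dist_eq (mul_pos (by linarith) hh) (dist_gridPoint_same hh hγ1 t k) y z
    · rw [if_neg hkl, zero_add]
      have hpos : 0 < γ * h * ‖k - l‖ :=
        mul_pos (by positivity) (norm_pos_iff.2 (sub_ne_zero.2 hkl))
      have hle := mul_norm_sub_le_dist_gridPoint hh hγ0 hγ1 t k l (hω₀ hy) (hω₀ hz)
      rw [rieszKernel_of_ne s (dist_pos.1 (hpos.trans_le hle)),
        ← Real.mul_rpow (by positivity) (norm_nonneg _)]
      exact Real.rpow_le_rpow_of_nonpos hpos hle (by linarith)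
  have hZ : ∀ k, ∑ l ∈ S, ‖k - l‖ ^ (-s) ≤ ∑' m : Fin d → ℤ, ‖m‖ ^ (-s) := by
    intro k
    have hsum := summable_norm_rpow_neg_fin hs
    rw [← (Equiv.subLeft k).tsum_eq]
    exact ((Equiv.subLeft k).summable_iff.2 hsum).sum_le_tsum S fun _ _ ↦ by positivity
  unfold realRieszEnergy
  rw [Finset.sum_image hinj, Finset.sum_product, ← nsmul_eq_mul]
  refine Finset.sum_le_card_nsmul _ _ _ fun k hk ↦ ?_
  calc _ ≤ ∑ y ∈ ω₀, ∑ l ∈ S, ∑ z ∈ ω₀,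
        ((if k = l then ((1 - γ) * h) ^ (-s) * rieszKernel s y z else 0) +
          (γ * h) ^ (-s) * ‖k - l‖ ^ (-s)) := by
        refine Finset.sum_le_sum fun y hy ↦ ?_
        rw [Finset.sum_image hinj, Finset.sum_product]
        exact Finset.sum_le_sum fun l hl ↦ Finset.sum_le_sum fun z hz ↦ hterm k hk y hy l hl z hz
    _ = ((1 - γ) * h) ^ (-s) *
          ∑ y ∈ ω₀, ∑ z ∈ ω₀, rieszKernel s y z +
        (ω₀.card : ℝ) ^ 2 * ((γ * h) ^ (-s) * ∑ l ∈ S, ‖k - l‖ ^ (-s)) := by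
        simp only [Finset.sum_add_distrib]
        congr 1
        · rw [Finset.mul_sum]
          refine Finset.sum_congr rfl fun y _ ↦ ?_
          rw [Finset.sum_comm, Finset.mul_sum]
          refine Finset.sum_congr rfl fun z _ ↦ ?_
          rw [Finset.sum_ite_eq, if_pos hk]
        · simp only [Finset.sum_const, nsmul_eq_mul, ← Finset.mul_sum]
          ring
    _ ≤ _ := by
        gcongr
        exact hZ k

theorem measurable_gridPoint_mem {A : Set (EuclideanSpace ℝ (Fin d))} (hA : MeasurableSet A)
    (h γ : ℝ) (k : Fin d → ℤ) (y : EuclideanSpace ℝ (Fin d)) :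
    MeasurableSet {t | gridPoint h γ t k y ∈ A} :=
  (measurable_id.add_const _) hA

theorem tsum_volume_gridPoint_mem {A : Set (EuclideanSpace ℝ (Fin d))} (hA : MeasurableSet A)
    {h : ℝ} (hh : 0 < h) (γ : ℝ) (y : EuclideanSpace ℝ (Fin d)) :
    ∑' k : Fin d → ℤ, volume ({t | gridPoint h γ t k y ∈ A} ∩ {t | gridIndex h 0 t = 0}) =
      volume A := by
  set a : EuclideanSpace ℝ (Fin d) := h • (1 - γ) • y
  have hk : ∀ k : Fin d → ℤ,
      volume ({t | gridPoint h γ t k y ∈ A} ∩ {t | gridIndex h 0 t = 0}) =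
        volume (A ∩ {x | gridIndex h a x = k}) := by
    intro k
    rw [← measure_preimage_add_right volume
      (h • (WithLp.toLp 2 (fun i ↦ (k i : ℝ)) + (1 - γ) • y)) (A ∩ {x | gridIndex h a x = k})]
    congr 1
    ext t
    refine and_congr Iff.rfl ?_
    change gridIndex h 0 t = 0 ↔ gridIndex h a (gridPoint h γ t k y) = k
    rw [gridIndex_eq_iff hh, gridIndex_eq_iff hh]
    refine forall_congr' fun i ↦ ?_
    rw [gridPoint_apply]
    simp only [a, PiLp.smul_apply, smul_eq_mul, PiLp.zero_apply, Pi.zero_apply, Int.cast_zero,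
      mem_Ico]
    constructor <;> rintro ⟨h1, h2⟩ <;> constructor <;> linarith
  simp only [hk]
  rw [← measure_iUnion]
  · congr 1
    ext x
    simp
  · exact fun k l hkl ↦ Set.disjoint_left.2 fun x hx hy ↦ hkl (hx.2.symm.trans hy.2)
  · exact fun k ↦ hA.inter (measurableSet_gridCell hh a k)

theorem exists_gridPoint_card_ge {A : Set (EuclideanSpace ℝ (Fin d))} (hA : MeasurableSet A)
    (hA' : volume A ≠ ∞) {h : ℝ} (hh : 0 < h) (γ : ℝ) (ω₀ : Finset (EuclideanSpace ℝ (Fin d))) {N : ℕ}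
    (hN : N * ENNReal.ofReal (h ^ d) ≤ ω₀.card * volume A) :
    ∃ t : EuclideanSpace ℝ (Fin d), ∃ S : Finset (Fin d → ℤ),
      N ≤ ((S ×ˢ ω₀).filter fun p ↦ gridPoint h γ t p.1 p.2 ∈ A).card := by
  let C : Set (EuclideanSpace ℝ (Fin d)) := {t | gridIndex h 0 t = 0}
  let f : (Fin d → ℤ) → EuclideanSpace ℝ (Fin d) → EuclideanSpace ℝ (Fin d) → ℝ≥0∞ :=
    fun k y ↦ {t | gridPoint h γ t k y ∈ A}.indicator 1
  have hf : ∀ k y, Measurable (f k y) := fun k y ↦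
    measurable_one.indicator (measurable_gridPoint_mem hA h γ k y)
  have hC : MeasurableSet C := measurableSet_gridCell hh 0 0
  have hvC : volume C = ENNReal.ofReal (h ^ d) := volume_gridCell hh 0 0
  have hhd : 0 < h ^ d := by positivity
  have hintegral : ∫⁻ t in C, ∑' k, ∑ y ∈ ω₀, f k y t = ω₀.card * volume A := by
    rw [lintegral_tsum fun k ↦ (Finset.measurable_fun_sum _ fun y _ ↦ hf k y).aemeasurable]
    simp only [lintegral_finsetSum _ fun y _ ↦ hf _ y]
    rw [Summable.tsum_finsetSum fun _ _ ↦ ENNReal.summable]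
    simp only [f, lintegral_indicator_one (measurable_gridPoint_mem hA h γ _ _),
      Measure.restrict_apply (measurable_gridPoint_mem hA h γ _ _)]
    simp only [C, tsum_volume_gridPoint_mem hA hh, Finset.sum_const, nsmul_eq_mul]
  have hC0 : volume C ≠ 0 := by rw [hvC]; simpa using hhd
  have hCtop : volume C ≠ ∞ := by rw [hvC]; exact ENNReal.ofReal_ne_top
  obtain ⟨t, -, ht⟩ := exists_setLAverage_le hC0 hC.nullMeasurableSet (f := fun t ↦ ∑' k, ∑ y ∈ ω₀, f k y t)
    (by rw [hintegral]; exact ENNReal.mul_ne_top (ENNReal.natCast_ne_top _) hA')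
  rw [setLAverage_eq, hintegral] at ht
  have hNt : (N : ℝ≥0∞) ≤ ∑' k, ∑ y ∈ ω₀, f k y t := by
    refine le_trans ?_ ht
    rw [ENNReal.le_div_iff_mul_le (Or.inl hC0) (Or.inl hCtop), hvC]
    exact hN
  refine ⟨t, ?_⟩
  rcases Nat.eq_zero_or_pos N with rfl | hNpos
  · exact ⟨∅, by simp⟩
  rw [ENNReal.tsum_eq_iSup_sum] at hNt
  have hlt : ((N - 1 : ℕ) : ℝ≥0∞) < N := by exact_mod_cast Nat.sub_lt hNpos one_pos
  obtain ⟨S, hS⟩ := lt_iSup_iff.1 (hlt.trans_le hNt)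
  refine ⟨S, ?_⟩
  have e : ∑ k ∈ S, ∑ y ∈ ω₀, f k y t =
      (((S ×ˢ ω₀).filter fun p ↦ gridPoint h γ t p.1 p.2 ∈ A).card : ℝ≥0∞) := by
    rw [← Finset.sum_product', Finset.card_filter, Nat.cast_sum]
    refine Finset.sum_congr rfl fun p _ ↦ ?_
    simp only [f, Set.indicator_apply, mem_ofPred_eq, Pi.one_apply]
    split_ifs <;> simp
  rw [e] at hS
  exact Nat.le_of_pred_lt (by exact_mod_cast hS)

end UpperBound

section Asymptotics

variable {d : ℕ} {s : ℝ}

theorem exists_card_ge_of_not_hasEnergyLowerBound (hs : 0 < s) {c : ℝ} (hc0 : 0 < c)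
    (hc : ¬ HasEnergyLowerBound d s c) (m : ℕ) :
    ∃ ω : Finset (EuclideanSpace ℝ (Fin d)), ↑ω ⊆ unitBox d ∧ m ≤ ω.card ∧
      realRieszEnergy s ω ≤ c * (ω.card : ℝ) ^ (1 + s / d) := by
  unfold HasEnergyLowerBound at hc
  push Not at hc
  obtain ⟨ω, hω, h⟩ := hc (c * (m : ℝ) ^ (1 + s / d)) (by positivity)
  have hE := realRieszEnergy_nonneg s ω
  have hm : 0 ≤ c * (m : ℝ) ^ (1 + s / d) := by positivity
  refine ⟨ω, hω, ?_, by linarith⟩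
  by_contra! hlt
  have : c * (ω.card : ℝ) ^ (1 + s / d) ≤ c * (m : ℝ) ^ (1 + s / d) := by gcongr
  linarith

theorem eventually_minRieszEnergy_le (hd : 1 ≤ d) (hs : (d : ℝ) < s) {c c' : ℝ} (hc0 : 0 < c)
    (hcc' : c < c') (hc : ¬ HasEnergyLowerBound d s c) {A : Set (EuclideanSpace ℝ (Fin d))}
    (hA : IsCompact A) (hA0 : 0 < volume A) :
    ∀ᶠ N : ℕ in atTop, minRieszEnergy s A N ≤
      ENNReal.ofReal (c' * (volume A).toReal ^ (-(s / d)) * (N : ℝ) ^ (1 + s / d)) := by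
  have hd0 : (0 : ℝ) < d := by positivity
  have hs0 : 0 < s := hd0.trans hs
  have hτ : 1 < s / d := (one_lt_div hd0).2 hs
  have hAtop : volume A ≠ ∞ := hA.measure_lt_top.ne
  set V := (volume A).toReal
  have hV : 0 < V := ENNReal.toReal_pos hA0.ne' hAtop
  set Z := ∑' m : Fin d → ℤ, ‖m‖ ^ (-s)
  have hZ : 0 ≤ Z := tsum_nonneg fun _ ↦ by positivity
  -- choose the shrinking factor
  obtain ⟨γ, hγc, hγ0, hγ1⟩ : ∃ γ : ℝ, (1 - γ) ^ (-s) * c < c' ∧ 0 < γ ∧ γ < 1 := by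
    have hcont : ContinuousAt (fun γ : ℝ ↦ (1 - γ) ^ (-s) * c) 0 :=
      ((continuousAt_const.sub continuousAt_id).rpow_const (Or.inl (by simp))).mul_const c
    have h1 : ∀ᶠ γ in 𝓝[>] (0 : ℝ), (1 - γ) ^ (-s) * c < c' :=
      (hcont.eventually_lt_const (by simpa using hcc')).filter_mono nhdsWithin_le_nhds
    have h2 : ∀ᶠ γ in 𝓝[>] (0 : ℝ), γ < 1 := (eventually_lt_nhds one_pos).filter_mono
      nhdsWithin_le_nhds
    obtain ⟨γ, ⟨h1, h2⟩, h3⟩ := ((h1.and h2).and self_mem_nhdsWithin).exists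
    exact ⟨γ, h1, h3, h2⟩
  -- choose the configuration in the unit cube
  obtain ⟨m, hm⟩ : ∃ m : ℕ, ∀ n ≥ m,
      (1 - γ) ^ (-s) * c + (n : ℝ) ^ (1 - s / d) * (γ ^ (-s) * Z) < c' := by
    have h0 : Tendsto (fun n : ℕ ↦ (n : ℝ) ^ (1 - s / d)) atTop (𝓝 0) := by
      have := (tendsto_rpow_neg_atTop (sub_pos.2 hτ)).comp (tendsto_natCast_atTop_atTop (R := ℝ))
      simpa only [neg_sub, Function.comp_def] using this
    have h1 := (h0.mul_const (γ ^ (-s) * Z)).const_add ((1 - γ) ^ (-s) * c)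
    rw [zero_mul, add_zero] at h1
    exact eventually_atTop.1 (h1.eventually_lt_const hγc)
  obtain ⟨ω₀, hω₀, hcard, hE₀⟩ :=
    exists_card_ge_of_not_hasEnergyLowerBound hs0 hc0 hc (max m 1)
  have hD := hm ω₀.card ((le_max_left _ _).trans hcard)
  set n : ℝ := (ω₀.card : ℝ) with hn_def
  have hn : 0 < n := by
    have : 0 < ω₀.card := lt_of_lt_of_le one_pos ((le_max_right _ _).trans hcard)
    exact Nat.cast_pos.2 this
  set D := (1 - γ) ^ (-s) * c + n ^ (1 - s / d) * (γ ^ (-s) * Z)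
  have h1γ : 0 < 1 - γ := by linarith
  have hD0 : 0 < D := by positivity
  set v := V * c' / D
  have hVv : V < v := by
    rw [lt_div_iff₀ hD0]
    gcongr
  obtain ⟨h₀, hh₀, H⟩ := exists_card_gridIndex_mul_le hA hVv
  have hN0 : ∀ᶠ N : ℕ in atTop, n * V / h₀ ^ d < N :=
    tendsto_natCast_atTop_atTop.eventually_gt_atTop _
  filter_upwards [hN0, eventually_gt_atTop 0] with N hNlarge hNpos
  have hN : (0 : ℝ) < N := mod_cast hNpos
  set h : ℝ := (n * V / N) ^ ((d : ℝ)⁻¹)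
  have hh : 0 < h := by positivity
  have hhd : h ^ d = n * V / N := Real.rpow_inv_natCast_pow (by positivity) (by lia)
  have hlt : h < h₀ := by
    refine lt_of_pow_lt_pow_left₀ d hh₀.le ?_
    rw [hhd, div_lt_iff₀ hN]
    rw [div_lt_iff₀ (by positivity)] at hNlarge
    linarith
  obtain ⟨t, S, hS⟩ := exists_gridPoint_card_ge hA.measurableSet hAtop hh γ ω₀ (N := N) (by
    rw [← ENNReal.ofReal_toReal hAtop, ← ENNReal.ofReal_natCast, ← ENNReal.ofReal_natCast,
      ← ENNReal.ofReal_mul hN.le, ← ENNReal.ofReal_mul hn.le, hhd]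
    refine ENNReal.ofReal_le_ofReal (le_of_eq ?_)
    change N * (n * V / N) = n * V
    field_simp)
  -- only keep the cells containing a point of `A`
  set S' := S.filter fun k ↦ ∃ y ∈ ω₀, gridPoint h γ t k y ∈ A
  set P : (Fin d → ℤ) × EuclideanSpace ℝ (Fin d) → EuclideanSpace ℝ (Fin d) :=
    fun p ↦ gridPoint h γ t p.1 p.2
  have hS' : ((S'.card : ℝ)) * h ^ d ≤ v := H h hh hlt t S' fun k hk ↦ by
    obtain ⟨y, hy, hyA⟩ := (Finset.mem_filter.1 hk).2
    exact ⟨_, hyA, gridIndex_gridPoint hh hγ0 hγ1 t k (hω₀ hy)⟩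
  set T := (S ×ˢ ω₀).filter fun p ↦ P p ∈ A
  have hT : T ⊆ S' ×ˢ ω₀ := fun p hp ↦ by
    obtain ⟨h1, h2⟩ := Finset.mem_filter.1 hp
    obtain ⟨h3, h4⟩ := Finset.mem_product.1 h1
    exact Finset.mem_product.2 ⟨Finset.mem_filter.2 ⟨h3, p.2, h4, h2⟩, h4⟩
  obtain ⟨T', hT', hT'card⟩ := Finset.exists_subset_card_eq hS
  have hinj : Set.InjOn P ↑T' := (gridPoint_injOn hh hγ0 hγ1 t).mono fun p hp ↦
    hω₀ (Finset.mem_product.1 (Finset.mem_filter.1 (hT' hp)).1).2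
  have hω : ↑(T'.image P) ⊆ A := fun x hx ↦ by
    obtain ⟨p, hp, rfl⟩ := Finset.mem_image.1 (Finset.mem_coe.1 hx)
    exact (Finset.mem_filter.1 (hT' hp)).2
  have hcardω : (T'.image P).card = N := by rw [Finset.card_image_of_injOn hinj, hT'card]
  refine (iInf₂_le_of_le (T'.image P) hω (iInf_le_of_le hcardω le_rfl)).trans ?_
  rw [rieszEnergy_eq_ofReal]
  refine ENNReal.ofReal_le_ofReal ?_
  have hmono : realRieszEnergy s (T'.image P) ≤ realRieszEnergy s ((S' ×ˢ ω₀).image P) :=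
    realRieszEnergy_mono (Finset.image_subset_image (hT'.trans hT))
  refine hmono.trans ((realRieszEnergy_image_gridPoint_le hs hh hγ0 hγ1 t hω₀ S').trans ?_)
  have hhd0 : 0 < h ^ d := by positivity
  have hnp : n ^ 2 = n ^ (1 + s / d) * n ^ (1 - s / d) := by
    rw [← Real.rpow_add hn, ← Real.rpow_natCast]
    congr 1
    push_cast
    ring
  have hhp : h ^ (-s) / h ^ d = (N : ℝ) ^ (1 + s / d) / (n ^ (1 + s / d) * V ^ (1 + s / d)) := by
    rw [← Real.mul_rpow hn.le hV.le, ← Real.div_rpow hN.le (by positivity),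
      rpow_neg_eq_pow_rpow hd hh, div_eq_mul_inv, ← Real.rpow_neg_one (h ^ d),
      ← Real.rpow_add hhd0, hhd, ← inv_div, Real.inv_rpow (by positivity),
      ← Real.rpow_neg (by positivity)]
    congr 1
    ring
  calc _ ≤ S'.card * (((1 - γ) * h) ^ (-s) * (c * n ^ (1 + s / d)) +
        n ^ 2 * ((γ * h) ^ (-s) * Z)) := by
        have : 0 ≤ (1 - γ) * h := by positivity
        gcongr
    _ = S'.card * (h ^ (-s) * n ^ (1 + s / d) * D) := by
        rw [Real.mul_rpow h1γ.le hh.le, Real.mul_rpow hγ0.le hh.le, hnp]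
        ring
    _ ≤ v / h ^ d * (h ^ (-s) * n ^ (1 + s / d) * D) := by
        gcongr
        rwa [le_div_iff₀ hhd0]
    _ = (v * D) * n ^ (1 + s / d) * (h ^ (-s) / h ^ d) := by ring
    _ = _ := by
        rw [hhp, div_mul_cancel₀ _ hD0.ne', Real.rpow_add hV, Real.rpow_one, Real.rpow_neg hV.le]
        field_simp

end Asymptotics

section Equidistribution

variable {d : ℕ} {s : ℝ}

theorem realRieszEnergy_filter_add_le {E : Type*} [MetricSpace E] (p : E → Prop) [DecidablePred p]
    (ω : Finset E) : realRieszEnergy s (ω.filter p) +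
      realRieszEnergy s (ω.filter (¬ p ·)) ≤ realRieszEnergy s ω := by
  unfold realRieszEnergy
  rw [← Finset.sum_filter_add_sum_filter_not ω p]
  refine add_le_add (Finset.sum_le_sum fun x _ ↦ ?_) (Finset.sum_le_sum fun x _ ↦ ?_) <;>
  exact Finset.sum_le_sum_of_subset_of_nonneg (Finset.filter_subset _ _)
    fun _ _ _ ↦ rieszKernel_nonneg s _ _

theorem HasEnergyLowerBound.le_of_frequently (hd : 1 ≤ d) (hs : 0 < s) {c l a : ℝ} (hc0 : 0 ≤ c)
    (hc : HasEnergyLowerBound d s c) {ω : ℕ → Finset (EuclideanSpace ℝ (Fin d))}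
    (hcard : ∀ N, (ω N).card = N)
    (hl : Tendsto (fun N : ℕ ↦ realRieszEnergy s (ω N) / (N : ℝ) ^ (1 + s / d)) atTop (𝓝 l))
    {B₁ B₂ : Set (EuclideanSpace ℝ (Fin d))} (hB₁ : IsCompact B₁) (hB₂ : IsCompact B₂)
    (hsub : ∀ N, ↑(ω N) ⊆ B₁ ∪ B₂)
    (hfreq : ∃ᶠ N : ℕ in atTop, a * N ≤ ((ω N).filter (· ∈ B₁)).card)
    {v₁ v₂ : ℝ} (hv₁ : (volume B₁).toReal < v₁) (hv₂ : (volume B₂).toReal < v₂)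
    {x₁ x₂ : ℝ} (hx₂ : 0 ≤ x₂) (hx : x₂ ≤ x₁) :
    c * ((1 + s / d) * x₁ ^ (s / d) * a - s / d * x₁ ^ (1 + s / d) * v₁ +
      ((1 + s / d) * x₂ ^ (s / d) * (1 - a) - s / d * x₂ ^ (1 + s / d) * v₂)) ≤ l := by
  have hτ : 0 < s / d := by positivity
  have hx₁ : 0 ≤ x₁ := hx₂.trans hx
  obtain ⟨K₁, H₁⟩ := hc.exists_le_of_isCompact hd hs hc0 hB₁ hv₁
  obtain ⟨K₂, H₂⟩ := hc.exists_le_of_isCompact hd hs hc0 hB₂ hv₂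
  have h0 : Tendsto (fun N : ℕ ↦ (K₁ + K₂) / (N : ℝ) ^ (1 + s / d)) atTop (𝓝 0) :=
    ((tendsto_rpow_atTop (by linarith)).comp tendsto_natCast_atTop_atTop).const_div_atTop _
  have h1 := hl.add h0
  rw [add_zero] at h1
  refine ge_of_tendsto_of_frequently h1
    ((hfreq.and_eventually (eventually_gt_atTop 0)).mono ?_)
  rintro N ⟨hN, hNpos⟩
  have hNp : (0 : ℝ) < N := mod_cast hNpos
  have e₁ := H₁ ((ω N).filter (· ∈ B₁)) (fun x hx ↦ (Finset.mem_filter.1 hx).2) (x₁ * N)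
    (by positivity)
  have e₂ := H₂ ((ω N).filter (· ∉ B₁))
    (fun x hx ↦ (hsub N (Finset.mem_filter.1 hx).1).resolve_left (Finset.mem_filter.1 hx).2)
    (x₂ * N) (by positivity)
  have e₃ := realRieszEnergy_filter_add_le (s := s) (· ∈ B₁) (ω N)
  have e₄ : (((ω N).filter (· ∉ B₁)).card : ℝ) = N - ((ω N).filter (· ∈ B₁)).card := by
    rw [eq_sub_iff_add_eq', ← Nat.cast_add, Finset.card_filter_add_card_filter_not, hcard]
  rw [e₄] at e₂
  rw [← add_div, le_div_iff₀ (by positivity)]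
  have hpow : (N : ℝ) ^ (1 + s / d) = N * (N : ℝ) ^ (s / d) := by
    rw [Real.rpow_add hNp, Real.rpow_one]
  rw [Real.mul_rpow hx₁ hNp.le, Real.mul_rpow hx₁ hNp.le, hpow] at e₁
  rw [Real.mul_rpow hx₂ hNp.le, Real.mul_rpow hx₂ hNp.le, hpow] at e₂
  rw [hpow]
  have hmono : x₂ ^ (s / d) ≤ x₁ ^ (s / d) := Real.rpow_le_rpow hx₂ hx hτ.le
  set n : ℝ := (((ω N).filter (· ∈ B₁)).card : ℝ)
  have e₅ : 0 ≤ c * ((1 + s / d) * (N : ℝ) ^ (s / d)) * ((x₁ ^ (s / d) - x₂ ^ (s / d)) *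
      (n - a * N)) := by
    have := mul_nonneg (sub_nonneg.2 hmono) (sub_nonneg.2 hN)
    positivity
  nlinarith

theorem exists_gt_tangent_gt {τ a b V : ℝ} (hτ : 0 < τ) (hV : 0 < V) (hab : b / V < a) :
    ∃ x > V⁻¹, (1 + τ) * (V⁻¹) ^ τ * a - τ * (V⁻¹) ^ (1 + τ) * b <
      (1 + τ) * x ^ τ * a - τ * x ^ (1 + τ) * b := by
  set y := V⁻¹
  have hy : 0 < y := inv_pos.2 hV
  set f : ℝ → ℝ := fun x ↦ (1 + τ) * x ^ τ * a - τ * x ^ (1 + τ) * b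
  have h1 : HasDerivAt f ((1 + τ) * (τ * y ^ (τ - 1)) * a - τ * ((1 + τ) * y ^ (1 + τ - 1)) * b) y :=
    (((Real.hasDerivAt_rpow_const (Or.inl hy.ne')).const_mul (1 + τ)).mul_const a).sub
      (((Real.hasDerivAt_rpow_const (Or.inl hy.ne')).const_mul τ).mul_const b)
  have h2 : 0 < (1 + τ) * (τ * y ^ (τ - 1)) * a - τ * ((1 + τ) * y ^ (1 + τ - 1)) * b := by
    have e : y ^ (1 + τ - 1) = y ^ (τ - 1) * y := by
      rw [← Real.rpow_add_one hy.ne']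
      congr 1
      ring
    rw [e]
    have h3 : 0 < a - b * y := by rwa [sub_pos, ← div_eq_mul_inv]
    have h4 : 0 < (1 + τ) * τ * y ^ (τ - 1) * (a - b * y) := by positivity
    linarith
  have h3 := (hasDerivAt_iff_tendsto_slope.1 h1).eventually_const_lt h2
  have h4 : ∀ᶠ x in 𝓝[>] y, 0 < slope f y x :=
    h3.filter_mono (nhdsWithin_mono _ fun x hx ↦ ne_of_gt hx)
  obtain ⟨x, hx, hxy⟩ := (h4.and self_mem_nhdsWithin).exists
  refine ⟨x, hxy, ?_⟩
  rw [slope_def_field, div_pos_iff_of_pos_right (sub_pos.2 hxy), sub_pos] at hx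
  exact hx

theorem eventually_card_filter_lt (hd : 1 ≤ d) (hs : (d : ℝ) < s)
    {A : Set (EuclideanSpace ℝ (Fin d))} (hA : IsCompact A) (hA0 : 0 < volume A)
    {ω : ℕ → Finset (EuclideanSpace ℝ (Fin d))}
    (hsub : ∀ N, ↑(ω N) ⊆ A) (hcard : ∀ N, (ω N).card = N) {L : ℝ≥0∞} (hLfin : L ≠ ⊤)
    (hmin : Tendsto
      (fun N : ℕ => minRieszEnergy s A N / ENNReal.ofReal ((N : ℝ) ^ (1 + s / (d : ℝ))))
      atTop (𝓝 L))
    (hω : Tendsto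
      (fun N : ℕ => rieszEnergy s (ω N) / ENNReal.ofReal ((N : ℝ) ^ (1 + s / (d : ℝ))))
      atTop (𝓝 L))
    {B₁ B₂ : Set (EuclideanSpace ℝ (Fin d))} (hB₁ : IsCompact B₁) (hB₂ : IsCompact B₂)
    (hAB : A ⊆ B₁ ∪ B₂)
    (hvol : (volume B₁).toReal + (volume B₂).toReal = (volume A).toReal) {a : ℝ}
    (ha : (volume B₁).toReal / (volume A).toReal < a) :
    ∀ᶠ N : ℕ in atTop, (((ω N).filter (· ∈ B₁)).card : ℝ) < a * N := by
  have hd0 : (0 : ℝ) < d := by positivity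
  have hs0 : 0 < s := hd0.trans hs
  have hτ : 0 < s / d := by positivity
  have hAtop : volume A ≠ ∞ := hA.measure_lt_top.ne
  set V := (volume A).toReal
  have hV : 0 < V := ENNReal.toReal_pos hA0.ne' hAtop
  have hl : Tendsto (fun N : ℕ ↦ realRieszEnergy s (ω N) / (N : ℝ) ^ (1 + s / d)) atTop
      (𝓝 L.toReal) := by
    refine ((ENNReal.tendsto_toReal hLfin).comp hω).congr fun N ↦ ?_
    rw [Function.comp_apply, rieszEnergy_eq_ofReal, ENNReal.toReal_div,
      ENNReal.toReal_ofReal (realRieszEnergy_nonneg _ _), ENNReal.toReal_ofReal (by positivity)]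
  set S := {c | HasEnergyLowerBound d s c}
  have hbdd : BddAbove S := by
    refine ⟨max 0 (L.toReal / ((V + 2)⁻¹) ^ (s / d)), fun c hc ↦ ?_⟩
    rcases le_total c 0 with hc0 | hc0
    · exact hc0.trans (le_max_left _ _)
    refine le_trans ?_ (le_max_right _ _)
    have hx : 0 < (V + 2)⁻¹ := by positivity
    have h := hc.le_of_frequently (a := 1) (v₁ := V + 1) (v₂ := 1) hd hs0 hc0 hcard hl hA
      isCompact_empty (by simpa using hsub)
      (Frequently.of_forall fun N ↦ by
        rw [one_mul, Finset.filter_true_of_mem fun x hx ↦ hsub N hx, hcard])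
      (lt_add_one _) (by simp) hx.le le_rfl
    rw [le_div_iff₀ (by positivity)]
    refine le_trans (le_of_eq ?_) h
    rw [Real.rpow_add hx, Real.rpow_one]
    field_simp
    ring
  obtain ⟨c₀, hc₀, hc₀S⟩ := exists_hasEnergyLowerBound hd hs0
  set C := sSup S
  have hC : 0 < C := hc₀.trans_le (le_csSup hbdd hc₀S)
  have hlt : ∀ c < C, HasEnergyLowerBound d s c := fun c hc ↦ by
    obtain ⟨c', hc', h⟩ := exists_lt_of_lt_csSup ⟨c₀, hc₀S⟩ hc
    exact HasEnergyLowerBound.mono hc' h.le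
  have hgt : ∀ c > C, ¬ HasEnergyLowerBound d s c := fun c hc h ↦
    hc.not_ge (le_csSup hbdd h)
  have hupper : L.toReal ≤ C * V⁻¹ ^ (s / d) := by
    rw [Real.inv_rpow hV.le, ← Real.rpow_neg hV.le]
    have key : ∀ c > C, L.toReal ≤ c * V ^ (-(s / d)) := fun c hc ↦ by
      have hc0 : 0 < c := hC.trans hc
      refine ENNReal.toReal_le_of_le_ofReal (by positivity) (le_of_tendsto hmin ?_)
      obtain ⟨c', hc', hcc'⟩ := exists_between hc
      filter_upwards [eventually_minRieszEnergy_le hd hs (hC.trans hc') hcc' (hgt c' hc') hA hA0,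
        eventually_gt_atTop 0] with N hN hNpos
      have hNp : (0 : ℝ) < N := mod_cast hNpos
      refine ENNReal.div_le_of_le_mul ?_
      rwa [← ENNReal.ofReal_mul (by positivity)]
    have : Tendsto (fun c ↦ c * V ^ (-(s / d))) (𝓝[>] C) (𝓝 (C * V ^ (-(s / d)))) :=
      ((continuous_id.mul continuous_const).tendsto C).mono_left nhdsWithin_le_nhds
    exact ge_of_tendsto this (eventually_nhdsWithin_of_forall key)
  by_contra hcon
  rw [not_eventually] at hcon
  have hfreq : ∃ᶠ N : ℕ in atTop, a * N ≤ ((ω N).filter (· ∈ B₁)).card :=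
    hcon.mono fun N hN ↦ not_lt.1 hN
  obtain ⟨x, hxV, hx⟩ := exists_gt_tangent_gt hτ hV ha
  set b₁ := (volume B₁).toReal
  set b₂ := (volume B₂).toReal
  let G : ℝ → ℝ := fun δ ↦ (C - δ) * ((1 + s / d) * x ^ (s / d) * a -
    s / d * x ^ (1 + s / d) * (b₁ + δ) + ((1 + s / d) * V⁻¹ ^ (s / d) * (1 - a) -
      s / d * V⁻¹ ^ (1 + s / d) * (b₂ + δ)))
  have hG : ∀ᶠ δ in 𝓝[>] (0 : ℝ), G δ ≤ L.toReal := by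
    have h1 : ∀ᶠ δ in 𝓝[>] (0 : ℝ), δ < C :=
      (eventually_lt_nhds hC).filter_mono nhdsWithin_le_nhds
    filter_upwards [h1, self_mem_nhdsWithin] with δ h1 h2
    have h2 : 0 < δ := h2
    exact (hlt (C - δ) (by linarith)).le_of_frequently hd hs0 (by linarith) hcard hl hB₁ hB₂
      (fun N ↦ (hsub N).trans hAB) hfreq (by linarith) (by linarith) (by positivity) hxV.le
  have hGcont : Tendsto G (𝓝[>] 0) (𝓝 (G 0)) := by
    have : Continuous G := by fun_prop
    exact (this.tendsto 0).mono_left nhdsWithin_le_nhds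
  have hG0 := (le_of_tendsto hGcont hG).trans hupper
  simp only [G, sub_zero, add_zero] at hG0
  have hG1 := le_of_mul_le_mul_left hG0 hC
  have hpow : V⁻¹ ^ (1 + s / d) * V = V⁻¹ ^ (s / d) := by
    rw [Real.rpow_add (inv_pos.2 hV), Real.rpow_one, mul_right_comm, inv_mul_cancel₀ hV.ne',
      one_mul]
  have hb₂ : b₂ = V - b₁ := by linarith
  rw [hb₂] at hG1
  have e : s / d * V⁻¹ ^ (1 + s / d) * (V - b₁) =
      s / d * V⁻¹ ^ (s / d) - s / d * V⁻¹ ^ (1 + s / d) * b₁ := by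
    rw [mul_sub, mul_assoc, hpow]
  rw [e] at hG1
  linarith

theorem sum_eq_integral_card_filter {E : Type*} {g : E → ℝ} {R : ℝ} (hg : ∀ x, 0 ≤ g x)
    (hgR : ∀ x, g x ≤ R) (ω : Finset E) :
    ∑ x ∈ ω, g x = ∫ t in Ioc 0 R, ((ω.filter (t ≤ g ·)).card : ℝ) := by
  have hind : ∀ x, (fun t ↦ if t ≤ g x then (1 : ℝ) else 0) = (Iic (g x)).indicator 1 := fun x ↦ by
    ext t
    simp [indicator_apply]
  simp only [Finset.card_filter, Nat.cast_sum, Nat.cast_ite, Nat.cast_one, Nat.cast_zero]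
  rw [integral_finsetSum]
  · refine Finset.sum_congr rfl fun x _ ↦ ?_
    rw [hind, integral_indicator_one measurableSet_Iic, measureReal_restrict_apply measurableSet_Iic,
      inter_comm, Ioc_inter_Iic, inf_eq_right.2 (hgR x), Real.volume_real_Ioc_of_le (hg x), sub_zero]
  · intro x _
    rw [hind]
    exact (integrable_const (1 : ℝ)).indicator measurableSet_Iic

theorem tendsto_card_filter_div (hd : 1 ≤ d) (hs : (d : ℝ) < s)
    {A : Set (EuclideanSpace ℝ (Fin d))} (hA : IsCompact A) (hA0 : 0 < volume A)
    {ω : ℕ → Finset (EuclideanSpace ℝ (Fin d))}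
    (hsub : ∀ N, ↑(ω N) ⊆ A) (hcard : ∀ N, (ω N).card = N) {L : ℝ≥0∞} (hLfin : L ≠ ⊤)
    (hmin : Tendsto
      (fun N : ℕ => minRieszEnergy s A N / ENNReal.ofReal ((N : ℝ) ^ (1 + s / (d : ℝ))))
      atTop (𝓝 L))
    (hω : Tendsto
      (fun N : ℕ => rieszEnergy s (ω N) / ENNReal.ofReal ((N : ℝ) ^ (1 + s / (d : ℝ))))
      atTop (𝓝 L))
    {g : EuclideanSpace ℝ (Fin d) → ℝ} (hg : Continuous g) {t : ℝ}
    (ht : volume.restrict A {x | g x = t} = 0) :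
    Tendsto (fun N : ℕ ↦ (((ω N).filter (t ≤ g ·)).card : ℝ) / N) atTop
      (𝓝 ((volume.restrict A).real {x | t ≤ g x} / (volume A).toReal)) := by
  have hAtop : volume A ≠ ∞ := hA.measure_lt_top.ne
  have : IsFiniteMeasure (volume.restrict A) := ⟨by simpa using hA.measure_lt_top⟩
  set V := (volume A).toReal
  have hV : 0 < V := ENNReal.toReal_pos hA0.ne' hAtop
  have hc₁ : IsClosed {x | t ≤ g x} := isClosed_le continuous_const hg
  have hc₂ : IsClosed {x | g x ≤ t} := isClosed_le hg continuous_const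
  have hB₁ := hA.inter_right hc₁
  have hB₂ := hA.inter_right hc₂
  have hAB : A ⊆ A ∩ {x | t ≤ g x} ∪ A ∩ {x | g x ≤ t} := fun x hx ↦
    (le_total t (g x)).imp (fun h ↦ ⟨hx, h⟩) fun h ↦ ⟨hx, h⟩
  have e₁ : (volume.restrict A).real {x | t ≤ g x} = (volume (A ∩ {x | t ≤ g x})).toReal := by
    rw [measureReal_restrict_apply hc₁.measurableSet, inter_comm]
    rfl
  have hvol : (volume (A ∩ {x | t ≤ g x})).toReal + (volume (A ∩ {x | g x ≤ t})).toReal = V := by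
    have e₂ : (volume.restrict A).real {x | g x ≤ t} = (volume (A ∩ {x | g x ≤ t})).toReal := by
      rw [measureReal_restrict_apply hc₂.measurableSet, inter_comm]
      rfl
    rw [← e₁, ← e₂, ← measureReal_union_add_inter hc₂.measurableSet]
    have h1 : {x | t ≤ g x} ∪ {x | g x ≤ t} = univ := eq_univ_of_forall fun x ↦ le_total t (g x)
    have h2 : {x | t ≤ g x} ∩ {x | g x ≤ t} = {x | g x = t} := by
      ext x
      exact ⟨fun h ↦ le_antisymm h.2 h.1, fun h ↦ ⟨h.ge, h.le⟩⟩
    rw [h1, h2, measureReal_def, measureReal_def, ht, Measure.restrict_apply_univ]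
    simp [V]
  have hf₁ : ∀ N, (ω N).filter (· ∈ A ∩ {x | t ≤ g x}) = (ω N).filter (t ≤ g ·) := fun N ↦
    Finset.filter_congr fun x hx ↦ ⟨fun h ↦ h.2, fun h ↦ ⟨hsub N hx, h⟩⟩
  have hf₂ : ∀ N, (ω N).filter (· ∈ A ∩ {x | g x ≤ t}) = (ω N).filter (g · ≤ t) := fun N ↦
    Finset.filter_congr fun x hx ↦ ⟨fun h ↦ h.2, fun h ↦ ⟨hsub N hx, h⟩⟩
  rw [e₁]
  refine tendsto_order.2 ⟨fun a ha ↦ ?_, fun a ha ↦ ?_⟩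
  · have ha' : (volume (A ∩ {x | g x ≤ t})).toReal / V < 1 - a := by
      rw [lt_div_iff₀ hV] at ha
      rw [div_lt_iff₀ hV]
      linarith
    filter_upwards [eventually_card_filter_lt hd hs hA hA0 hsub hcard hLfin hmin hω hB₂ hB₁
      (by rwa [union_comm]) (by rwa [add_comm]) ha', eventually_gt_atTop 0] with N hN hNpos
    have hN' : (((ω N).filter (g · ≤ t)).card : ℝ) < (1 - a) * N := by
      rw [← hf₂]
      convert hN
    rw [lt_div_iff₀ (mod_cast hNpos)]
    have h1 : (N : ℝ) ≤ ((ω N).filter (t ≤ g ·)).card + ((ω N).filter (g · ≤ t)).card := by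
      rw [← Nat.cast_add, Nat.cast_le, ← hcard N]
      refine le_trans (Finset.card_le_card fun x hx ↦ ?_) (Finset.card_union_le _ _)
      simpa [Finset.mem_filter, Finset.mem_union, hcard, hx] using le_total t (g x)
    linarith
  · filter_upwards [eventually_card_filter_lt hd hs hA hA0 hsub hcard hLfin hmin hω hB₁ hB₂
      hAB hvol ha, eventually_gt_atTop 0] with N hN hNpos
    have hN' : (((ω N).filter (t ≤ g ·)).card : ℝ) < a * N := by
      rw [← hf₁]
      convert hN
    rwa [div_lt_iff₀ (mod_cast hNpos)]

end Equidistribution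

/-- asymptotically `s`-energy minimizing configurations (for `s > d`) on a compact
set `A ⊆ ℝ^d` of positive measure are asymptotically uniformly distributed with respect to
`H_d` on `A`. -/
theorem asympt_minimizing_equidistributed (d : ℕ) (hd : 1 ≤ d) (s : ℝ) (hs : (d : ℝ) < s)
    (A : Set (EuclideanSpace ℝ (Fin d))) (hA : IsCompact A) (hA0 : 0 < volume A)
    (ω : ℕ → Finset (EuclideanSpace ℝ (Fin d)))
    (hsub : ∀ N, ↑(ω N) ⊆ A) (hcard : ∀ N, (ω N).card = N)
    (L : ℝ≥0∞) (hLfin : L ≠ ⊤)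
    (hmin : Tendsto
      (fun N : ℕ => minRieszEnergy s A N / ENNReal.ofReal ((N : ℝ) ^ (1 + s / (d : ℝ))))
      atTop (𝓝 L))
    (hω : Tendsto
      (fun N : ℕ => rieszEnergy s (ω N) / ENNReal.ofReal ((N : ℝ) ^ (1 + s / (d : ℝ))))
      atTop (𝓝 L)) :
    ∀ f : EuclideanSpace ℝ (Fin d) → ℝ, Continuous f → (∃ M : ℝ, ∀ x, |f x| ≤ M) →
      Tendsto (fun N : ℕ => (1 / (N : ℝ)) * ∑ x ∈ ω N, f x) atTop
        (𝓝 ((∫ x in A, f x) / (volume A).toReal)) := by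
  rintro f hf ⟨M, hM⟩
  have hAtop : volume A ≠ ∞ := hA.measure_lt_top.ne
  have : IsFiniteMeasure (volume.restrict A) := ⟨by simpa using hA.measure_lt_top⟩
  have hV : 0 < (volume A).toReal := ENNReal.toReal_pos hA0.ne' hAtop
  have hg0 : ∀ x, 0 ≤ f x + M := fun x ↦ by linarith [(abs_le.1 (hM x)).1]
  have hgR : ∀ x, f x + M ≤ 2 * M := fun x ↦ by linarith [(abs_le.1 (hM x)).2]
  have hgc : Continuous fun x ↦ f x + M := by fun_prop
  have hfint : Integrable f (volume.restrict A) := hf.continuousOn.integrableOn_compact hA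
  have hae : ∀ᵐ t : ℝ, volume.restrict A {x | f x + M = t} = 0 := by
    have h := (Measure.countable_meas_level_set_pos (μ := volume.restrict A)
      hgc.measurable).ae_notMem volume
    filter_upwards [h] with t ht
    simpa using ht
  have hlim : Tendsto
      (fun N : ℕ ↦ ∫ t in Ioc 0 (2 * M), (((ω N).filter (t ≤ f · + M)).card : ℝ) / N) atTop
      (𝓝 (∫ t in Ioc 0 (2 * M),
        (volume.restrict A).real {x | t ≤ f x + M} / (volume A).toReal)) := by
    refine tendsto_integral_of_dominated_convergence (fun _ ↦ 1) (fun N ↦ ?_)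
      (integrable_const _) (fun N ↦ .of_forall fun t ↦ ?_) (ae_restrict_of_ae ?_)
    · refine (Antitone.measurable fun a b hab ↦ ?_).aestronglyMeasurable
      gcongr with x
    · rw [Real.norm_of_nonneg (by positivity)]
      refine div_le_one_of_le₀ ?_ (by positivity)
      exact_mod_cast (Finset.card_filter_le _ _).trans (hcard N).le
    · filter_upwards [hae] with t ht
      exact tendsto_card_filter_div hd hs hA hA0 hsub hcard hLfin hmin hω hgc ht
  have hintegral : ∫ t in Ioc 0 (2 * M), (volume.restrict A).real {x | t ≤ f x + M} =
      (∫ x in A, f x) + M * (volume A).toReal := by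
    have hgint : Integrable (fun x ↦ f x + M) (volume.restrict A) :=
      hfint.add (integrable_const M)
    rw [← hgint.integral_eq_integral_Ioc_meas_le (.of_forall hg0) (.of_forall hgR),
      integral_add hfint (integrable_const M)]
    simp [measureReal_def, mul_comm]
  rw [integral_div, hintegral, add_div, mul_div_cancel_right₀ _ hV.ne'] at hlim
  have hlim' := hlim.sub_const M
  rw [add_sub_cancel_right] at hlim'
  refine hlim'.congr' ?_
  filter_upwards [eventually_gt_atTop 0] with N hN
  have hN0 : (N : ℝ) ≠ 0 := by positivity
  rw [integral_div, ← sum_eq_integral_card_filter hg0 hgR, Finset.sum_add_distrib,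
    Finset.sum_const, hcard, nsmul_eq_mul]
  field_simp
  ring
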